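/- If the multi-GGS-group G = ⟨a,b_1,…,b_r⟩ has r ≥ 2 directed generators, then ψ(st_G(1)′) = G′ × ⋯ × G′ (p factors). In particular, ψ(st_G(1)) contains G′ × ⋯ × G′, i.e., G is regular branch over its commutator subgroup G′. -/

import Mathlib

/-!
Automorphisms of the `p`-regular rooted tree, encoded by portraits:
an automorphism is a family of permutations of `Fin p`, one for each vertex
(vertices are finite words over `Fin p`, the root being `[]`).
-/

namespace TreeAut

variable {p : ℕ}

/-- Automorphisms of the `p`-regular rooted tree, given by their portraits. -/
def AutT (p : ℕ) : Type := List (Fin p) → Equiv.Perm (Fin p)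

namespace AutT

/-- The action of a tree automorphism on the vertices (finite words over `Fin p`). -/
def act : AutT p → List (Fin p) → List (Fin p)
  | _, [] => []
  | f, x :: w => f [] x :: act (fun v => f (x :: v)) w

/-- The section of `f` at the level-one vertex `x`; the map
`f ↦ (sections f 0, …, sections f (p-1))` restricted to the first-level
stabilizer is the isomorphism `ψ`. -/
def sections (f : AutT p) : Fin p → AutT p := fun x v => f (x :: v)

instance : One (AutT p) := ⟨fun _ => 1⟩

instance : Mul (AutT p) := ⟨fun f g v => f (act g v) * g v⟩

/-- The action of the inverse automorphism on vertices. -/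
def invAct : AutT p → List (Fin p) → List (Fin p)
  | _, [] => []
  | f, x :: w => (f [])⁻¹ x :: invAct (fun v => f (((f [])⁻¹ x) :: v)) w

instance : Inv (AutT p) := ⟨fun f v => (f (invAct f v))⁻¹⟩

lemma one_apply (v : List (Fin p)) : (1 : AutT p) v = 1 := rfl

lemma mul_apply (f g : AutT p) (v : List (Fin p)) : (f * g) v = f (act g v) * g v := rfl

lemma inv_apply (f : AutT p) (v : List (Fin p)) : f⁻¹ v = (f (invAct f v))⁻¹ := rfl

lemma act_nil (f : AutT p) : act f [] = [] := rfl

lemma act_cons (f : AutT p) (x : Fin p) (w : List (Fin p)) :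
    act f (x :: w) = f [] x :: act (sections f x) w := rfl

lemma sections_mul (f g : AutT p) (x : Fin p) :
    sections (f * g) x = sections f (g [] x) * sections g x :=
  funext fun _ => rfl

lemma act_one : ∀ v : List (Fin p), act (1 : AutT p) v = v
  | [] => rfl
  | x :: w => congrArg (x :: ·) (act_one w)

lemma act_mul (f g : AutT p) : ∀ v : List (Fin p), act (f * g) v = act f (act g v)
  | [] => rfl
  | x :: w => by
      rw [act_cons (f * g), sections_mul, act_mul, act_cons g, act_cons f]
      rfl

lemma invAct_act (f : AutT p) : ∀ v : List (Fin p), invAct f (act f v) = v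
  | [] => rfl
  | x :: w => by
      rw [act_cons]
      show (f [])⁻¹ (f [] x) ::
          invAct (fun v => f (((f [])⁻¹ (f [] x)) :: v)) (act (sections f x) w) = x :: w
      have h : (f [])⁻¹ (f [] x) = x := Equiv.symm_apply_apply (f []) x
      refine (congrArg (fun y : Fin p =>
        y :: invAct (fun v => f (y :: v)) (act (sections f x) w)) h).trans ?_
      exact congrArg (x :: ·) (invAct_act (sections f x) w)

instance : Group (AutT p) where
  mul_assoc f g h := by
    funext v
    show (f * g) (act h v) * h v = f (act (g * h) v) * (g * h) v
    rw [mul_apply, mul_apply, act_mul, mul_assoc]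
  one_mul f := by
    funext v
    show (1 : AutT p) (act f v) * f v = f v
    rw [one_apply, one_mul]
  mul_one f := by
    funext v
    show f (act (1 : AutT p) v) * (1 : AutT p) v = f v
    rw [act_one, one_apply, mul_one]
  inv_mul_cancel f := by
    funext v
    show f⁻¹ (act f v) * f v = (1 : AutT p) v
    rw [inv_apply, invAct_act, one_apply, inv_mul_cancel]

lemma act_length (f : AutT p) : ∀ v : List (Fin p), (act f v).length = v.length
  | [] => rfl
  | _ :: w => congrArg Nat.succ (act_length _ w)

lemma act_act_inv (f : AutT p) (v : List (Fin p)) : act f (act f⁻¹ v) = v := by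
  rw [← act_mul, mul_inv_cancel, act_one]

/-- The pointwise stabilizer `st(n)` of the `n`-th level of the tree. -/
def levelStab (p n : ℕ) : Subgroup (AutT p) where
  carrier := {f | ∀ v : List (Fin p), v.length = n → act f v = v}
  one_mem' := fun v _ => act_one v
  mul_mem' := by
    intro f g hf hg v hv
    rw [act_mul, hg v hv, hf v hv]
  inv_mem' := by
    intro f hf v hv
    have h1 : act f (act f⁻¹ v) = v := act_act_inv f v
    have h2 : act f (act f⁻¹ v) = act f⁻¹ v := hf _ (by rw [act_length, hv])
    exact h2.symm.trans h1

instance levelStab_normal (p n : ℕ) : (levelStab p n).Normal := by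
  constructor
  intro f hf g v hv
  show act (g * f * g⁻¹) v = v
  rw [act_mul, act_mul, hf _ (by rw [act_length, hv]), act_act_inv]

/-- The tuple of sections at the level-two vertices.  Restricted to the
second-level stabilizer this is the map `ψ₂`. -/
def sections2 (f : AutT p) : Fin p → Fin p → AutT p := fun x y v => f (x :: y :: v)

/-- The rooted automorphism defined by a permutation `σ` of `Fin p`. -/
def rooted (σ : Equiv.Perm (Fin p)) : AutT p := fun v => if v = [] then σ else 1

/-- The rooted automorphism `a`, acting at the root by the cycle `(1 2 … p)`. -/
def rootedA (p : ℕ) : AutT p := rooted (finRotate p)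

/-- Auxiliary portrait for the directed automorphism `b_e`. -/
def directedAux (e : Fin (p - 1) → ZMod p) : List (Fin p) → Equiv.Perm (Fin p)
  | [] => 1
  | x :: w =>
      if h : (x : ℕ) < p - 1 then
        (if w = [] then finRotate p ^ ((e ⟨x, h⟩).val) else 1)
      else directedAux e w

/-- The directed automorphism `b_e` defined by the vector `e ∈ 𝔽_p^{p-1}`,
i.e. the unique automorphism with `ψ(b_e) = (a^{e_1}, …, a^{e_{p-1}}, b_e)`. -/
def directed (e : Fin (p - 1) → ZMod p) : AutT p := directedAux e

/-- The multi-GGS-group determined by the vectors `e 1, …, e r`. -/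
def multiGGS (p : ℕ) {r : ℕ} (e : Fin r → Fin (p - 1) → ZMod p) : Subgroup (AutT p) :=
  Subgroup.closure ({rootedA p} ∪ Set.range fun i => directed (e i))

/-- The GGS-group `𝒢` defined by the (nonzero) constant vector `(c, …, c)`. -/
def constGGS (p : ℕ) (c : ZMod p) : Subgroup (AutT p) :=
  Subgroup.closure {rootedA p, directed (fun _ => c)}

/-- `G` is the GGS-group `𝒢` defined by a constant vector. -/
def IsConstGGS {p : ℕ} (G : Subgroup (AutT p)) : Prop :=
  ∃ c : ZMod p, c ≠ 0 ∧ G = constGGS p c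

/-- The stabilizer `st_G(n) = G ∩ st(n)`, viewed as a subgroup of `G`. -/
def stabIn {p : ℕ} (G : Subgroup (AutT p)) (n : ℕ) : Subgroup G :=
  (levelStab p n).comap G.subtype

instance {p : ℕ} (G : Subgroup (AutT p)) (n : ℕ) : (stabIn G n).Normal :=
  Subgroup.Normal.comap (levelStab_normal p n) G.subtype

/-- The congruence subgroup property: every finite-index subgroup of `G`
contains a level stabilizer `st_G(n)`. -/
def HasCSP {p : ℕ} (G : Subgroup (AutT p)) : Prop :=
  ∀ H : Subgroup G, H.FiniteIndex → ∃ n : ℕ, stabIn G n ≤ H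

/-- `G` is just infinite: it is infinite and all its nontrivial normal
subgroups have finite index. -/
def JustInfinite {p : ℕ} (G : Subgroup (AutT p)) : Prop :=
  Infinite G ∧ ∀ N : Subgroup G, N.Normal → N ≠ ⊥ → N.FiniteIndex

end AutT

end TreeAut

open TreeAut AutT Subgroup
open scoped commutatorElement

namespace TreeAut.AutT

variable {p : ℕ}

lemma mem_levelStab_one_iff {f : AutT p} : f ∈ levelStab p 1 ↔ f [] = 1 := by
  refine ⟨fun h => Equiv.ext fun x => ?_, fun h v hv => ?_⟩
  · have := h [x] rfl
    rw [act_cons] at this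
    exact (List.cons.inj this).1
  · obtain ⟨x, rfl⟩ := List.length_eq_one_iff.1 hv
    rw [act_cons, h, act_nil]
    rfl

/-- The map `ψ` on the first-level stabilizer, as a group homomorphism. -/
def psi (p : ℕ) : levelStab p 1 →* (Fin p → AutT p) where
  toFun f := sections f.1
  map_one' := rfl
  map_mul' f g := funext fun x => by
    rw [Subgroup.coe_mul, sections_mul, mem_levelStab_one_iff.1 g.2]
    rfl

lemma psi_apply (f : levelStab p 1) : psi p f = sections f.1 := rfl

lemma sections_inv (f : AutT p) (x : Fin p) :
    sections f⁻¹ x = (sections f (f⁻¹ [] x))⁻¹ := by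
  have h := sections_mul f f⁻¹ x
  rw [mul_inv_cancel] at h
  exact eq_inv_of_mul_eq_one_right h.symm

lemma rootedA_nil : rootedA p [] = finRotate p := rfl

lemma sections_rootedA (x : Fin p) : sections (rootedA p) x = 1 :=
  funext fun _ => rfl

lemma rootedA_pow_nil (k : ℕ) : (rootedA p ^ k) [] = finRotate p ^ k := by
  induction k with
  | zero => rfl
  | succ k ih => rw [pow_succ, mul_apply, act_nil, ih, pow_succ, rootedA_nil]

lemma sections_rootedA_pow (k : ℕ) (x : Fin p) : sections (rootedA p ^ k) x = 1 := by
  induction k generalizing x with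
  | zero => rfl
  | succ k ih => rw [pow_succ, sections_mul, ih, sections_rootedA, one_mul]

lemma rootedA_pow_apply (k : ℕ) (w : List (Fin p)) :
    (rootedA p ^ k) w = if w = [] then finRotate p ^ k else 1 := by
  cases w with
  | nil => simp [rootedA_pow_nil]
  | cons x w =>
    rw [if_neg (List.cons_ne_nil x w)]
    exact congrFun (sections_rootedA_pow k x) w

lemma val_finRotate_pow (k : ℕ) (x : Fin p) :
    ((finRotate p ^ k) x : ℕ) = (x + k) % p := by
  cases p with
  | zero => exact x.elim0
  | succ n =>
    induction k with
    | zero => simp [Nat.mod_eq_of_lt x.2]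
    | succ k ih =>
      rw [pow_succ', Equiv.Perm.mul_apply, finRotate_apply, Fin.val_add, ih]
      simp [add_assoc]

lemma finRotate_pow_self : finRotate p ^ p = 1 := by
  ext x
  rw [val_finRotate_pow, Nat.add_mod_right, Nat.mod_eq_of_lt x.2]
  rfl

lemma rootedA_pow_self : rootedA p ^ p = 1 :=
  funext fun w => by
    rw [rootedA_pow_apply, finRotate_pow_self, ite_self]
    rfl

lemma rootedA_pow_val_add [NeZero p] (c d : ZMod p) :
    rootedA p ^ (c + d).val = rootedA p ^ c.val * rootedA p ^ d.val := by
  rw [ZMod.val_add, ← pow_add]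
  exact (pow_eq_pow_mod _ rootedA_pow_self).symm

lemma directed_nil (v : Fin (p - 1) → ZMod p) : directed v [] = 1 := rfl

lemma sections_directed_of_lt (v : Fin (p - 1) → ZMod p) {x : Fin p} (h : (x : ℕ) < p - 1) :
    sections (directed v) x = rootedA p ^ (v ⟨x, h⟩).val :=
  funext fun w => by
    rw [rootedA_pow_apply]
    show directedAux v (x :: w) = _
    rw [directedAux, dif_pos h]

lemma sections_directed_of_not_lt (v : Fin (p - 1) → ZMod p) {x : Fin p}
    (h : ¬ (x : ℕ) < p - 1) : sections (directed v) x = directed v :=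
  funext fun w => by
    show directedAux v (x :: w) = _
    rw [directedAux, dif_neg h]
    rfl

lemma directed_add [NeZero p] (v w : Fin (p - 1) → ZMod p) :
    directed (v + w) = directed v * directed w := by
  funext l
  induction l with
  | nil => rfl
  | cons x l ih =>
    show sections (directed (v + w)) x l = sections (directed v * directed w) x l
    rw [sections_mul, directed_nil, Equiv.Perm.one_apply]
    by_cases h : (x : ℕ) < p - 1
    · simp only [sections_directed_of_lt _ h, Pi.add_apply, rootedA_pow_val_add]
    · simpa only [sections_directed_of_not_lt _ h] using ih

/-- Directed automorphisms as a homomorphism from the additive group of defining vectors. -/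
def directedHom (p : ℕ) [NeZero p] :
    Multiplicative (Fin (p - 1) → ZMod p) →* AutT p :=
  MonoidHom.mk' (fun v => directed v.toAdd) fun v w => directed_add v.toAdd w.toAdd

lemma directed_comm [NeZero p] (v w : Fin (p - 1) → ZMod p) :
    directed v * directed w = directed w * directed v := by
  rw [← directed_add, add_comm, directed_add]

/-- The vectors whose directed automorphism lies in a given subgroup. -/
def directedVectors [NeZero p] (G : Subgroup (AutT p)) : AddSubgroup (Fin (p - 1) → ZMod p) :=
  Subgroup.toAddSubgroup' (G.comap (directedHom p))

lemma directed_mem_of_mem_span [NeZero p] {r : ℕ} {e : Fin r → Fin (p - 1) → ZMod p}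
    {v : Fin (p - 1) → ZMod p} (hv : v ∈ Submodule.span (ZMod p) (Set.range e)) :
    directed v ∈ multiGGS p e := by
  have h : Submodule.span (ZMod p) (Set.range e) ≤
      AddSubgroup.toZModSubmodule p (directedVectors (multiGGS p e)) := by
    rw [Submodule.span_le]
    rintro _ ⟨i, rfl⟩
    exact subset_closure (Or.inr ⟨i, rfl⟩)
  exact h hv

lemma rootedA_mem_multiGGS {r : ℕ} (e : Fin r → Fin (p - 1) → ZMod p) :
    rootedA p ∈ multiGGS p e := subset_closure (Or.inl rfl)

lemma sections_mem_multiGGS {r : ℕ} {e : Fin r → Fin (p - 1) → ZMod p} {g : AutT p}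
    (hg : g ∈ multiGGS p e) (x : Fin p) : sections g x ∈ multiGGS p e := by
  induction hg using closure_induction generalizing x with
  | mem g hg =>
    rcases hg with rfl | ⟨i, rfl⟩
    · rw [sections_rootedA]
      exact one_mem _
    · by_cases h : (x : ℕ) < p - 1
      · simp only [sections_directed_of_lt _ h]
        exact pow_mem (rootedA_mem_multiGGS e) _
      · simp only [sections_directed_of_not_lt _ h]
        exact subset_closure (Or.inr ⟨i, rfl⟩)
  | one => exact one_mem _
  | mul f g _ _ hf hg =>
    rw [sections_mul]
    exact mul_mem (hf _) (hg _)
  | inv f _ hf =>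
    rw [sections_inv]
    exact inv_mem (hf _)

lemma sections_conj_rootedA_pow (k : ℕ) (f : AutT p) (x : Fin p) :
    sections (rootedA p ^ k * f * (rootedA p ^ k)⁻¹) ((finRotate p ^ k) x) = sections f x := by
  have h := sections_mul (rootedA p ^ k * f * (rootedA p ^ k)⁻¹) (rootedA p ^ k) x
  rw [inv_mul_cancel_right, sections_mul, sections_rootedA_pow, sections_rootedA_pow, one_mul,
    mul_one, rootedA_pow_nil] at h
  exact h.symm

lemma exists_finRotate_pow (x y : Fin p) : ∃ k : ℕ, (finRotate p ^ k) x = y := by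
  refine ⟨y + (p - x), Fin.ext ?_⟩
  have hx := x.2
  rw [val_finRotate_pow, show (x : ℕ) + (y + (p - x)) = y + p by omega, Nat.add_mod_right,
    Nat.mod_eq_of_lt y.2]

/-- The intersection of a subgroup with the first-level stabilizer is normalized by it. -/
lemma conj_mem_stab {G : Subgroup (AutT p)} {g f : AutT p} (hg : g ∈ G)
    (hf : f ∈ levelStab p 1 ⊓ G) : g * f * g⁻¹ ∈ levelStab p 1 ⊓ G :=
  ⟨(levelStab_normal p 1).conj_mem f hf.1 g, G.mul_mem (G.mul_mem hg hf.2) (G.inv_mem hg)⟩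

end TreeAut.AutT

/-- If a subspace `E` is not spanned by one vector and a subspace `S` contains the vectors
of `E` killed by a coordinate `d` whenever the coordinate `τ d` is nonzero on `E`,
then `S` contains `E`. -/
theorem Submodule.le_of_coordinate_kernels {K ι : Type*} [Field K] {E S : Submodule K (ι → K)}
    (τ : ι → ι) (hτ : ∀ d, τ (τ d) = d) (hE : ∀ w ∈ E, ∃ u ∈ E, ∀ c : K, u ≠ c • w)
    (h : ∀ d, ∀ w ∈ E, w (τ d) ≠ 0 → ∀ v ∈ E, v d = 0 → v ∈ S) : E ≤ S := by
  intro w hw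
  by_contra hwS
  have key : ∀ d, ∀ u ∈ E, u d ≠ 0 → ∀ v ∈ E, v d = 0 → v ∈ S := by
    intro d u hu hud v hv hvd
    by_cases hz : ∃ x ∈ E, x (τ d) ≠ 0
    · obtain ⟨x, hx, hxd⟩ := hz
      exact h d x hx hxd v hv hvd
    · push Not at hz
      exact h (τ d) u hu (by rwa [hτ]) v hv (hz v hv)
  have hw0 : w ≠ 0 := fun h0 => hwS (h0 ▸ S.zero_mem)
  obtain ⟨d, hd⟩ := Function.ne_iff.1 hw0
  obtain ⟨u, hu, hne⟩ := hE w hw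
  have hd' : w d ≠ 0 := hd
  have hxE : u - (u d / w d) • w ∈ E := E.sub_mem hu (E.smul_mem _ hw)
  have hxS := key d w hw hd _ hxE (by simp [hd'])
  obtain ⟨d', hd''⟩ := Function.ne_iff.1 (sub_ne_zero.2 (hne (u d / w d)))
  generalize u - (u d / w d) • w = x at hxE hxS hd''
  have hxd : x d' ≠ 0 := hd''
  have hy := key d' x hxE hxd (w - (w d' / x d') • x) (E.sub_mem hw (E.smul_mem _ hxE))
    (by simp [hxd])
  exact hwS (by simpa using S.add_mem hy (S.smul_mem (w d' / x d') hxS))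

/-- The commutator subgroup of a subgroup `G` generated by `s` lies in any subgroup normalized
by `G` that contains the commutators of elements of `s`. -/
theorem Subgroup.commutator_closure_le {Γ : Type*} [Group Γ] {s : Set Γ} {L : Subgroup Γ}
    (hL : ∀ h ∈ closure s, ∀ g ∈ L, h * g * h⁻¹ ∈ L) (hs : ∀ x ∈ s, ∀ y ∈ s, ⁅x, y⁆ ∈ L) :
    ⁅closure s, closure s⁆ ≤ L := by
  rw [commutator_le]
  intro x hx y hy
  induction hx, hy using closure_induction₂ with
  | mem x y hx hy => exact hs x hx y hy
  | one_left x hx => simp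
  | one_right x hx => simp
  | mul_left x y z hx hy hz h₁ h₂ =>
    rw [show ⁅x * y, z⁆ = x * ⁅y, z⁆ * x⁻¹ * ⁅x, z⁆ by simp only [commutatorElement_def]; group]
    exact mul_mem (hL x hx _ h₂) h₁
  | mul_right y z x hy hz hx h₁ h₂ =>
    rw [show ⁅x, y * z⁆ = ⁅x, y⁆ * (y * ⁅x, z⁆ * y⁻¹) by simp only [commutatorElement_def]; group]
    exact mul_mem h₁ (hL y hy _ h₂)
  | inv_left x y hx hy h =>
    rw [show ⁅x⁻¹, y⁆ = x⁻¹ * ⁅x, y⁆⁻¹ * x⁻¹⁻¹ by simp only [commutatorElement_def]; group]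
    exact hL _ (inv_mem hx) _ (inv_mem h)
  | inv_right x y hx hy h =>
    rw [show ⁅x, y⁻¹⁆ = y⁻¹ * ⁅x, y⁆⁻¹ * y⁻¹⁻¹ by simp only [commutatorElement_def]; group]
    exact hL _ (inv_mem hy) _ (inv_mem h)

namespace TreeAut.AutT

variable {p : ℕ}

/-- The image under `ψ` of the derived subgroup of `st_G(1)`. -/
def psiDerived (G : Subgroup (AutT p)) : Subgroup (Fin p → AutT p) :=
  (⁅levelStab p 1 ⊓ G, levelStab p 1 ⊓ G⁆.subgroupOf (levelStab p 1)).map (psi p)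

lemma derived_stab_le (G : Subgroup (AutT p)) :
    ⁅levelStab p 1 ⊓ G, levelStab p 1 ⊓ G⁆ ≤ levelStab p 1 ⊓ G :=
  commutator_le.2 fun _ hx _ hy => by
    rw [commutatorElement_def]
    exact mul_mem (mul_mem (mul_mem hx hy) (inv_mem hx)) (inv_mem hy)

lemma coe_psiDerived (G : Subgroup (AutT p)) :
    (psiDerived G : Set (Fin p → AutT p)) =
      sections '' (⁅levelStab p 1 ⊓ G, levelStab p 1 ⊓ G⁆ : Subgroup (AutT p)) := by
  ext g
  constructor
  · rintro ⟨f, hf, rfl⟩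
    exact ⟨f.1, hf, rfl⟩
  · rintro ⟨f, hf, rfl⟩
    exact ⟨⟨f, (derived_stab_le G hf).1⟩, hf, rfl⟩

lemma sections_mem_psiDerived {G : Subgroup (AutT p)} {f : AutT p}
    (hf : f ∈ ⁅levelStab p 1 ⊓ G, levelStab p 1 ⊓ G⁆) : sections f ∈ psiDerived G :=
  ⟨⟨f, (derived_stab_le G hf).1⟩, hf, rfl⟩

lemma commutator_sections_mem_psiDerived {G : Subgroup (AutT p)} {f g : AutT p}
    (hf : f ∈ levelStab p 1 ⊓ G) (hg : g ∈ levelStab p 1 ⊓ G) :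
    ⁅sections f, sections g⁆ ∈ psiDerived G :=
  ⟨⁅(⟨f, hf.1⟩ : levelStab p 1), (⟨g, hg.1⟩ : levelStab p 1)⁆, commutator_mem_commutator hf hg,
    map_commutatorElement (psi p) _ _⟩

lemma conj_mem_derived_stab {G : Subgroup (AutT p)} {g f : AutT p} (hg : g ∈ G)
    (hf : f ∈ ⁅levelStab p 1 ⊓ G, levelStab p 1 ⊓ G⁆) :
    g * f * g⁻¹ ∈ ⁅levelStab p 1 ⊓ G, levelStab p 1 ⊓ G⁆ := by
  have h : ⁅levelStab p 1 ⊓ G, levelStab p 1 ⊓ G⁆ ≤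
      ⁅levelStab p 1 ⊓ G, levelStab p 1 ⊓ G⁆.comap (MulAut.conj g).toMonoidHom := by
    refine commutator_le.2 fun x hx y hy => ?_
    rw [mem_comap, map_commutatorElement]
    exact commutator_mem_commutator (conj_mem_stab hg hx) (conj_mem_stab hg hy)
  exact h hf

lemma conj_sections_mem_psiDerived {G : Subgroup (AutT p)} {f : AutT p} {g : Fin p → AutT p}
    (hf : f ∈ levelStab p 1 ⊓ G) (hg : g ∈ psiDerived G) :
    sections f * g * (sections f)⁻¹ ∈ psiDerived G := by
  obtain ⟨c, hc, rfl⟩ := hg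
  refine ⟨⟨f, hf.1⟩ * c * ⟨f, hf.1⟩⁻¹, conj_mem_derived_stab hf.2 hc, ?_⟩
  simp only [map_mul, map_inv, psi_apply]

lemma psiDerived_multiGGS_le {r : ℕ} (e : Fin r → Fin (p - 1) → ZMod p) :
    psiDerived (multiGGS p e) ≤
      Subgroup.pi Set.univ fun _ => ⁅multiGGS p e, multiGGS p e⁆ := by
  have h : ⁅levelStab p 1 ⊓ multiGGS p e, levelStab p 1 ⊓ multiGGS p e⁆ ≤
      ((Subgroup.pi Set.univ fun _ => ⁅multiGGS p e, multiGGS p e⁆).comap (psi p)).map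
        (levelStab p 1).subtype := by
    refine commutator_le.2 fun x hx y hy =>
      ⟨⁅(⟨x, hx.1⟩ : levelStab p 1), (⟨y, hy.1⟩ : levelStab p 1)⁆, fun i _ => ?_, rfl⟩
    rw [map_commutatorElement]
    exact commutator_mem_commutator (sections_mem_multiGGS hx.2 i) (sections_mem_multiGGS hy.2 i)
  rintro _ ⟨f, hf, rfl⟩
  obtain ⟨f', hmem, hff⟩ := h hf
  obtain rfl : f' = f := Subtype.ext hff
  exact hmem

/-- The vertex of the first level at which directed automorphisms have a directed section. -/
def lastVertex (p : ℕ) [NeZero p] : Fin p := ⟨p - 1, Nat.sub_lt (NeZero.pos p) one_pos⟩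

/-- The elements of `G` that, placed at the last vertex, belong to `ψ(st_G(1)')`. -/
def lastSlot [NeZero p] (G : Subgroup (AutT p)) : Subgroup (AutT p) :=
  (psiDerived G).comap (MonoidHom.mulSingle (fun _ => AutT p) (lastVertex p))

lemma mem_lastSlot [NeZero p] {G : Subgroup (AutT p)} {g : AutT p} :
    g ∈ lastSlot G ↔ Pi.mulSingle (lastVertex p) g ∈ psiDerived G := Iff.rfl

/-- Elements of the last slot can be moved to any vertex. -/
lemma mulSingle_mem_psiDerived [NeZero p] {G : Subgroup (AutT p)} (ha : rootedA p ∈ G)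
    {g : AutT p} (hg : g ∈ lastSlot G) (x : Fin p) : Pi.mulSingle x g ∈ psiDerived G := by
  obtain ⟨c, hc, hcg⟩ := mem_lastSlot.1 hg
  rw [psi_apply] at hcg
  obtain ⟨k, rfl⟩ := exists_finRotate_pow (lastVertex p) x
  have hmem := sections_mem_psiDerived (conj_mem_derived_stab (pow_mem ha k) hc)
  convert hmem using 1
  funext y
  obtain ⟨z, rfl⟩ := (finRotate p ^ k).surjective y
  refine Eq.trans ?_ (sections_conj_rootedA_pow k c.1 z).symm
  have h := congrFun hcg z
  rw [show sections (c : AutT p) z = _ from h]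
  simp only [Pi.mulSingle_apply, EmbeddingLike.apply_eq_iff_eq]

lemma directed_mem_stab [NeZero p] {r : ℕ} {e : Fin r → Fin (p - 1) → ZMod p}
    {v : Fin (p - 1) → ZMod p} (hv : v ∈ Submodule.span (ZMod p) (Set.range e)) :
    directed v ∈ levelStab p 1 ⊓ multiGGS p e :=
  ⟨mem_levelStab_one_iff.2 (directed_nil v), directed_mem_of_mem_span hv⟩

lemma sections_directed_lastVertex [NeZero p] (v : Fin (p - 1) → ZMod p) :
    sections (directed v) (lastVertex p) = directed v :=
  sections_directed_of_not_lt v (lt_irrefl _)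

/-- Some vector in a nonzero span, after scaling, has a prescribed nonzero coordinate equal
to one. -/
lemma exists_coordinate_eq_one [Fact p.Prime] {E : Submodule (ZMod p) (Fin (p - 1) → ZMod p)}
    {w : Fin (p - 1) → ZMod p} (hw : w ∈ E) {d : Fin (p - 1)} (hd : w d ≠ 0) :
    ∃ u ∈ E, u d = 1 :=
  ⟨(w d)⁻¹ • w, E.smul_mem _ hw, by simp [hd]⟩

/-- The first-level stabilizer projects onto the whole group at the last vertex. -/
lemma exists_stab_sections_lastVertex [Fact p.Prime] {r : ℕ} {e : Fin r → Fin (p - 1) → ZMod p}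
    {w : Fin (p - 1) → ZMod p} (hw : w ∈ Submodule.span (ZMod p) (Set.range e)) (hw0 : w ≠ 0)
    {h : AutT p} (hh : h ∈ multiGGS p e) :
    ∃ f ∈ levelStab p 1 ⊓ multiGGS p e, sections f (lastVertex p) = h := by
  have hle : multiGGS p e ≤ ((multiGGS p e).subgroupOf (levelStab p 1)).map
      ((Pi.evalMonoidHom (fun _ => AutT p) (lastVertex p)).comp (psi p)) := by
    refine (closure_le _).2 ?_
    rintro _ (rfl | ⟨i, rfl⟩)
    · obtain ⟨d, hd⟩ := Function.ne_iff.1 hw0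
      obtain ⟨u, hu, hud⟩ := exists_coordinate_eq_one hw hd
      obtain ⟨k, hk⟩ := exists_finRotate_pow ⟨d, by omega⟩ (lastVertex p)
      have hf := conj_mem_stab (pow_mem (rootedA_mem_multiGGS e) k) (directed_mem_stab hu)
      refine ⟨⟨_, hf.1⟩, hf.2, ?_⟩
      have hs := sections_conj_rootedA_pow k (directed u) ⟨d, by omega⟩
      rw [hk, sections_directed_of_lt u d.2, Fin.eta, hud,
        ZMod.val_one'' (Fact.out : p.Prime).one_lt.ne', pow_one] at hs
      exact hs
    · have hf := directed_mem_stab (e := e) (Submodule.subset_span ⟨i, rfl⟩)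
      exact ⟨⟨_, hf.1⟩, hf.2, sections_directed_lastVertex (e i)⟩
  obtain ⟨f, hf, hfh⟩ := hle hh
  exact ⟨f.1, ⟨f.2, hf⟩, hfh⟩

lemma conj_mem_lastSlot [Fact p.Prime] {r : ℕ} {e : Fin r → Fin (p - 1) → ZMod p}
    {w : Fin (p - 1) → ZMod p} (hw : w ∈ Submodule.span (ZMod p) (Set.range e)) (hw0 : w ≠ 0)
    {h : AutT p} (hh : h ∈ multiGGS p e) {g : AutT p} (hg : g ∈ lastSlot (multiGGS p e)) :
    h * g * h⁻¹ ∈ lastSlot (multiGGS p e) := by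
  obtain ⟨f, hf, rfl⟩ := exists_stab_sections_lastVertex hw hw0 hh
  rw [mem_lastSlot]
  convert conj_sections_mem_psiDerived hf (mem_lastSlot.1 hg) using 1
  funext y
  by_cases hy : y = lastVertex p
  · subst hy
    simp
  · simp [hy]

/-- If `v` vanishes at `d` and some `w` does not vanish at the reversed coordinate, then the
commutator of `b_v` with a suitable conjugate of `b_w` is concentrated at the last vertex. -/
lemma commutator_directed_mem_lastSlot [Fact p.Prime] {r : ℕ}
    {e : Fin r → Fin (p - 1) → ZMod p} {v w : Fin (p - 1) → ZMod p}
    (hv : v ∈ Submodule.span (ZMod p) (Set.range e))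
    (hw : w ∈ Submodule.span (ZMod p) (Set.range e)) {d : Fin (p - 1)}
    (hvd : v d = 0) (hwd : w d.rev ≠ 0) :
    ⁅directed v, rootedA p⁆ ∈ lastSlot (multiGGS p e) := by
  obtain ⟨u, hu, hud⟩ := exists_coordinate_eq_one hw hwd
  have hp := (Fact.out : p.Prime).one_lt
  have hf := conj_mem_stab (pow_mem (rootedA_mem_multiGGS e) (d + 1)) (directed_mem_stab hu)
  rw [mem_lastSlot]
  convert commutator_sections_mem_psiDerived (directed_mem_stab hv) hf using 1
  funext y
  show _ = ⁅sections (directed v) y, sections _ y⁆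
  obtain ⟨z, rfl⟩ := (finRotate p ^ ((d : ℕ) + 1)).surjective y
  rw [sections_conj_rootedA_pow]
  have hval := val_finRotate_pow (d + 1) z
  have hz := z.2
  have hd := d.2
  by_cases hlast : (finRotate p ^ ((d : ℕ) + 1)) z = lastVertex p
  · have hzd : (z : ℕ) = d.rev := by
      rw [hlast] at hval
      simp only [lastVertex] at hval
      rw [Fin.val_rev]
      by_cases hlt : (z : ℕ) + (d + 1) < p
      · rw [Nat.mod_eq_of_lt hlt] at hval
        omega
      · rw [Nat.mod_eq_sub_mod (by omega), Nat.mod_eq_of_lt (by omega)] at hval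
        omega
    have hzlt : (z : ℕ) < p - 1 := hzd ▸ d.rev.2
    have hzr : (⟨z, hzlt⟩ : Fin (p - 1)) = d.rev := Fin.ext hzd
    rw [hlast, sections_directed_lastVertex, sections_directed_of_lt u hzlt, hzr, hud,
      ZMod.val_one'' hp.ne', pow_one, Pi.mulSingle_eq_same]
  · rw [Pi.mulSingle_eq_of_ne hlast]
    have hlt : ((finRotate p ^ ((d : ℕ) + 1)) z : ℕ) < p - 1 := by
      have h1 := ((finRotate p ^ ((d : ℕ) + 1)) z).2
      have h2 : ((finRotate p ^ ((d : ℕ) + 1)) z : ℕ) ≠ p - 1 := fun h => hlast (Fin.ext h)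
      omega
    rw [sections_directed_of_lt v hlt]
    by_cases hzlt : (z : ℕ) < p - 1
    · rw [sections_directed_of_lt u hzlt]
      exact (commutatorElement_eq_one_iff_commute.2
        (((Commute.refl (rootedA p)).pow_pow _ _))).symm
    · have hyd : (⟨_, hlt⟩ : Fin (p - 1)) = d := Fin.ext (by
        show ((finRotate p ^ ((d : ℕ) + 1)) z : ℕ) = d
        rw [hval, show (z : ℕ) + (d + 1) = d + p by omega, Nat.add_mod_right,
          Nat.mod_eq_of_lt (by omega)])
      rw [hyd, hvd, ZMod.val_zero, pow_zero, commutatorElement_one_left]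

/-- If `r ≥ 2`, then `[b_v, a]` lies in the last slot for every `v` in the span of the defining
vectors. -/
lemma commutator_directed_mem_lastSlot_of_mem_span [Fact p.Prime] {r : ℕ} (hr : 2 ≤ r)
    {e : Fin r → Fin (p - 1) → ZMod p} (he : LinearIndependent (ZMod p) e)
    {v : Fin (p - 1) → ZMod p} (hv : v ∈ Submodule.span (ZMod p) (Set.range e)) :
    ⁅directed v, rootedA p⁆ ∈ lastSlot (multiGGS p e) := by
  set E := Submodule.span (ZMod p) (Set.range e)
  have hmem : ∀ i, e i ∈ E := fun i => Submodule.subset_span ⟨i, rfl⟩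
  have h0 : e ⟨0, by omega⟩ ≠ 0 := he.ne_zero _
  let S : AddSubgroup (Fin (p - 1) → ZMod p) :=
    { carrier := {v | v ∈ E ∧ ⁅directed v, rootedA p⁆ ∈ lastSlot (multiGGS p e)}
      zero_mem' := by
        refine ⟨E.zero_mem, ?_⟩
        rw [show directed (0 : Fin (p - 1) → ZMod p) = 1 from map_one (directedHom p),
          commutatorElement_one_left]
        exact one_mem _
      add_mem' := by
        rintro v w ⟨hv, hv'⟩ ⟨hw, hw'⟩
        refine ⟨E.add_mem hv hw, ?_⟩
        rw [directed_add, show ⁅directed v * directed w, rootedA p⁆ =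
          directed v * ⁅directed w, rootedA p⁆ * (directed v)⁻¹ * ⁅directed v, rootedA p⁆ by
            simp only [commutatorElement_def]; group]
        exact mul_mem (conj_mem_lastSlot (hmem _) h0 (directed_mem_of_mem_span hv) hw') hv'
      neg_mem' := by
        rintro v ⟨hv, hv'⟩
        refine ⟨E.neg_mem hv, ?_⟩
        rw [show directed (-v) = (directed v)⁻¹ from
            map_inv (directedHom p) (Multiplicative.ofAdd v),
          show ⁅(directed v)⁻¹, rootedA p⁆ =
            (directed v)⁻¹ * ⁅directed v, rootedA p⁆⁻¹ * (directed v)⁻¹⁻¹ by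
              simp only [commutatorElement_def]; group]
        exact conj_mem_lastSlot (hmem _) h0 (inv_mem (directed_mem_of_mem_span hv))
          (inv_mem hv') }
  have hES : E ≤ AddSubgroup.toZModSubmodule p S := by
    refine Submodule.le_of_coordinate_kernels Fin.rev Fin.rev_rev (fun w _ => ?_)
      fun d w hw hwd v hv hvd => ⟨hv, commutator_directed_mem_lastSlot hv hw hvd hwd⟩
    by_contra! hcon
    obtain ⟨c₀, hc₀⟩ := hcon _ (hmem ⟨0, by omega⟩)
    obtain ⟨c₁, hc₁⟩ := hcon _ (hmem ⟨1, by omega⟩)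
    have hc : c₀ ≠ 0 := by
      rintro rfl
      exact h0 (by simpa using hc₀)
    have h01 : (⟨0, by omega⟩ : Fin r) ≠ ⟨1, by omega⟩ := by simp
    refine (linearIndepOn_pair_iff e h01 h0).1 (he.linearIndepOn _) (c₁ / c₀) ?_
    rw [hc₀, hc₁, smul_smul, div_mul_cancel₀ _ hc]
  exact (hES hv).2

end TreeAut.AutT

/-- If a multi-GGS-group `G` has `r ≥ 2` directed generators, then
`ψ(st_G(1)') = G' × ⋯ × G'` (`p` factors); in particular `ψ(st_G(1))` contains
`G' × ⋯ × G'`, i.e. `G` is regular branch over `G'`. -/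
theorem psi_derived_stab_eq_of_two_le
    (p r : ℕ) (hp : p.Prime) (hpodd : Odd p) (hr : 2 ≤ r)
    (e : Fin r → Fin (p - 1) → ZMod p) (he : LinearIndependent (ZMod p) e) :
    sections '' ((⁅levelStab p 1 ⊓ multiGGS p e, levelStab p 1 ⊓ multiGGS p e⁆ : Subgroup (AutT p)) : Set (AutT p))
        = {g : Fin p → AutT p | ∀ x : Fin p, g x ∈ ⁅multiGGS p e, multiGGS p e⁆} ∧
    {g : Fin p → AutT p | ∀ x : Fin p, g x ∈ ⁅multiGGS p e, multiGGS p e⁆}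
        ⊆ sections '' ((levelStab p 1 ⊓ multiGGS p e : Subgroup (AutT p)) : Set (AutT p)) := by
  have : Fact p.Prime := ⟨hp⟩
  have hmem : ∀ i, e i ∈ Submodule.span (ZMod p) (Set.range e) :=
    fun i => Submodule.subset_span ⟨i, rfl⟩
  have hslot : ⁅multiGGS p e, multiGGS p e⁆ ≤ lastSlot (multiGGS p e) := by
    refine commutator_closure_le
      (fun h hh g hg => conj_mem_lastSlot (hmem _) (he.ne_zero ⟨0, by omega⟩) hh hg) ?_
    rintro _ (rfl | ⟨i, rfl⟩) _ (rfl | ⟨j, rfl⟩)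
    · rw [commutatorElement_self]
      exact one_mem _
    · rw [← commutatorElement_inv]
      exact inv_mem (commutator_directed_mem_lastSlot_of_mem_span hr he (hmem j))
    · exact commutator_directed_mem_lastSlot_of_mem_span hr he (hmem i)
    · rw [commutatorElement_eq_one_iff_mul_comm.2 (directed_comm _ _)]
      exact one_mem _
  have heq : sections '' ((⁅levelStab p 1 ⊓ multiGGS p e, levelStab p 1 ⊓ multiGGS p e⁆ :
      Subgroup (AutT p)) : Set (AutT p))
      = {g : Fin p → AutT p | ∀ x : Fin p, g x ∈ ⁅multiGGS p e, multiGGS p e⁆} := by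
    rw [← coe_psiDerived]
    ext g
    exact ⟨fun hg x => psiDerived_multiGGS_le e hg x trivial, fun hg =>
      pi_mem_of_mulSingle_mem g fun x =>
        mulSingle_mem_psiDerived (rootedA_mem_multiGGS e) (hslot (hg x)) x⟩
  exact ⟨heq, heq ▸ Set.image_mono (derived_stab_le _)⟩
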